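/- arXiv:2411.06886 — 2 statements merged into one kernel-verified Lean document; each statement's English description precedes it below -/
import Mathlib

section
/- Let r₁, r₂, r₃ be positive real numbers satisfying the three equations (1/3)r₁² + (1/6)r₂² = 5/2, (1/12)r₁² + (1/6)r₂² + (3/4)r₃² = 5/2, and r₁⁴·r₂²·r₃⁴ = 432. Then r₁ = √6, r₂ = √3, and r₃ = √2. -/
/-- Algebraic heart of the spectral uniqueness proof for the Grassmannian of
oriented 2-planes in `ℝ⁷`: positive reals `r₁, r₂, r₃` satisfying the two
eigenvalue equations and the volume equation must equal `(√6, √3, √2)`. -/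
theorem isospectral_forces_symmetric_gr2_7
    (r₁ r₂ r₃ : ℝ) (h₁ : 0 < r₁) (h₂ : 0 < r₂) (h₃ : 0 < r₃)
    (heig₁ : (1 / 3) * r₁ ^ 2 + (1 / 6) * r₂ ^ 2 = 5 / 2)
    (heig₂ : (1 / 12) * r₁ ^ 2 + (1 / 6) * r₂ ^ 2 + (3 / 4) * r₃ ^ 2 = 5 / 2)
    (hvol : r₁ ^ 4 * r₂ ^ 2 * r₃ ^ 4 = 432) :
    r₁ = Real.sqrt 6 ∧ r₂ = Real.sqrt 3 ∧ r₃ = Real.sqrt 2 := by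
  have hz : r₃ ^ 2 = r₁ ^ 2 / 3 := by linarith
  have hy : r₂ ^ 2 = 15 - 2 * r₁ ^ 2 := by linarith
  -- Eliminating `r₂` and `r₃` leaves a quintic in `r₁ ^ 2` with the double root `6`.
  have hprod : (r₁ ^ 2 - 6) ^ 2 *
      (2 * (r₁ ^ 2) ^ 3 + 9 * (r₁ ^ 2) ^ 2 + 36 * r₁ ^ 2 + 108) = 0 := by
    rw [hy, show r₃ ^ 4 = (r₃ ^ 2) ^ 2 by ring, hz] at hvol
    linear_combination -9 * hvol
  have hx : r₁ ^ 2 = 6 := by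
    have hpos : 2 * (r₁ ^ 2) ^ 3 + 9 * (r₁ ^ 2) ^ 2 + 36 * r₁ ^ 2 + 108 ≠ 0 := by positivity
    exact sub_eq_zero.mp (pow_eq_zero_iff two_ne_zero |>.mp
      ((mul_eq_zero.mp hprod).resolve_right hpos))
  refine ⟨?_, ?_, ?_⟩ <;> symm
  · exact (Real.sqrt_eq_iff_eq_sq (by norm_num) h₁.le).mpr (by linarith)
  · exact (Real.sqrt_eq_iff_eq_sq (by norm_num) h₂.le).mpr (by linarith)
  · exact (Real.sqrt_eq_iff_eq_sq (by norm_num) h₃.le).mpr (by linarith)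
end

section
/- Let r₁, r₂, r₃ be positive real numbers satisfying the three equations (3/10)r₁² + (9/40)r₂² = 9/2, (1/15)r₁² + (9/40)r₂² + (14/15)r₃² = 9/2, and r₁⁴·r₂³·r₃⁸ = 93312. Then r₁² = 12, r₂ = 2, and r₃² = 3. -/
/-- Algebraic heart of the spectral uniqueness proof for the Grassmannian of
oriented 3-planes in `ℝ⁸`: positive reals `r₁, r₂, r₃` satisfying the two
eigenvalue equations and the volume equation must satisfy `r₁² = 12`, `r₂ = 2`,
`r₃² = 3`. -/
theorem isospectral_forces_symmetric_gr3_8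
    (r₁ r₂ r₃ : ℝ) (h₁ : 0 < r₁) (h₂ : 0 < r₂) (h₃ : 0 < r₃)
    (heig₁ : (3 / 10) * r₁ ^ 2 + (9 / 40) * r₂ ^ 2 = 9 / 2)
    (heig₂ : (1 / 15) * r₁ ^ 2 + (9 / 40) * r₂ ^ 2 + (14 / 15) * r₃ ^ 2 = 9 / 2)
    (hvol : r₁ ^ 4 * r₂ ^ 3 * r₃ ^ 8 = 93312) :
    r₁ ^ 2 = 12 ∧ r₂ = 2 ∧ r₃ ^ 2 = 3 := by
  have hz : r₃ ^ 2 = r₁ ^ 2 / 4 := by linarith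
  have hx : r₁ ^ 2 = 3 / 4 * (20 - r₂ ^ 2) := by linarith
  have hlt : r₂ ^ 2 < 20 := by nlinarith [pow_pos h₁ 2]
  have hcube : ((r₁ ^ 2) ^ 2 * r₂) ^ 3 = 288 ^ 3 := by
    have hz4 : r₃ ^ 8 = (r₁ ^ 2 / 4) ^ 4 := by rw [← hz]; ring
    rw [hz4] at hvol
    linear_combination 256 * hvol
  have hroot : (r₁ ^ 2) ^ 2 * r₂ = 288 :=
    (pow_left_inj₀ (by positivity) (by norm_num) three_ne_zero).mp hcube
  rw [hx] at hroot
  have hfactor : (r₂ - 2) ^ 2 * (r₂ * (r₂ ^ 2 - 28) + 4 * (r₂ ^ 2 - 32)) = 0 := by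
    linear_combination 16 / 9 * hroot
  have hneg : r₂ * (r₂ ^ 2 - 28) + 4 * (r₂ ^ 2 - 32) < 0 := by
    linarith [mul_neg_of_pos_of_neg h₂ (show r₂ ^ 2 - 28 < 0 by linarith)]
  have h2 : r₂ = 2 :=
    sub_eq_zero.mp (pow_eq_zero_iff two_ne_zero |>.mp
      ((mul_eq_zero.mp hfactor).resolve_right hneg.ne))
  subst h2
  exact ⟨by linarith, rfl, by linarith⟩
end
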